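/- arXiv:2309.01750 — 2 statements merged into one kernel-verified Lean document; each statement's English description precedes it below -/
import Mathlib

section
/- If φ is an arbitrary CNF formula ucp-equivalent to Ψ_{n,k} (where 1 ≤ k ≤ n−1), then there is a prime CNF formula φ' ucp-equivalent to Ψ_{n,k} such that |φ'| ≤ |φ| and ‖φ'‖ ≤ ‖φ‖. -/
/-- A literal on variables `x_1, …, x_n`: a variable together with a polarity
(`true` = positive literal, `false` = negative literal). -/
abbrev Lit (n : ℕ) := Fin n × Bool

/-- A clause is a finite set of literals. -/
abbrev Clause (n : ℕ) := Finset (Lit n)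

/-- A CNF formula is a finite set of clauses. -/
abbrev CnfFormula (n : ℕ) := Finset (Clause n)

/-- Negation of a literal. -/
def negLit {n : ℕ} (l : Lit n) : Lit n := (l.1, !l.2)

/-- A clause is well-formed if its literals are on pairwise distinct variables. -/
def Clause.Wf {n : ℕ} (C : Clause n) : Prop :=
  ∀ l ∈ C, ∀ l' ∈ C, l.1 = l'.1 → l = l'

/-- A partial assignment: a set of literals containing no complementary pair. -/
def IsPartialAssignment {n : ℕ} (α : Finset (Lit n)) : Prop :=
  ∀ l ∈ α, negLit l ∉ α

/-- The set of unit clauses corresponding to a set of literals. -/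
def unitClauses {n : ℕ} (α : Finset (Lit n)) : CnfFormula n :=
  α.image (fun l => {l})

/-- `UcpDeriv φ l` says that `l` lies in the least set `U` of literals closed under
the rule: if `C ∈ φ`, `l ∈ C`, and the negation of every literal of `C \ {l}`
lies in `U`, then `l ∈ U`. -/
inductive UcpDeriv {n : ℕ} (φ : CnfFormula n) : Lit n → Prop
  | step (C : Clause n) (hC : C ∈ φ) (l : Lit n) (hl : l ∈ C)
      (h : ∀ l' ∈ C.erase l, UcpDeriv φ (negLit l')) : UcpDeriv φ l

/-- The set of literals derived by unit clause propagation on `φ`. -/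
def UcpSet {n : ℕ} (φ : CnfFormula n) : Set (Lit n) := {l | UcpDeriv φ l}

/-- UCP on `φ` reaches the contradiction `⊥`: for some clause `C ∈ φ`, the negation of
every literal of `C` is derived. -/
def UcpBot {n : ℕ} (φ : CnfFormula n) : Prop :=
  ∃ C ∈ φ, ∀ l ∈ C, UcpDeriv φ (negLit l)

/-- Formulas `φ₁` and `φ₂` are ucp-equivalent: for every partial assignment `α`,
`UCP(φ₁ ∪ α) = UCP(φ₂ ∪ α)` (either both are `{⊥}`, or neither is and the derived
sets of literals coincide). -/
def UcpEquiv {n : ℕ} (φ₁ φ₂ : CnfFormula n) : Prop :=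
  ∀ α : Finset (Lit n), IsPartialAssignment α →
    (UcpBot (φ₁ ∪ unitClauses α) ↔ UcpBot (φ₂ ∪ unitClauses α)) ∧
    (¬ UcpBot (φ₁ ∪ unitClauses α) →
      UcpSet (φ₁ ∪ unitClauses α) = UcpSet (φ₂ ∪ unitClauses α))

/-- A total assignment satisfies a literal. -/
def SatLit {n : ℕ} (a : Fin n → Bool) (l : Lit n) : Prop := a l.1 = l.2

/-- A total assignment satisfies a clause if it satisfies some literal of it. -/
def SatClause {n : ℕ} (a : Fin n → Bool) (C : Clause n) : Prop := ∃ l ∈ C, SatLit a l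

/-- A total assignment satisfies a formula if it satisfies every clause of it. -/
def SatFormula {n : ℕ} (a : Fin n → Bool) (φ : CnfFormula n) : Prop :=
  ∀ C ∈ φ, SatClause a C


instance {n : ℕ} (C : Clause n) : Decidable (Clause.Wf C) :=
  decidable_of_iff (∀ l ∈ C, ∀ l' ∈ C, l.1 = l'.1 → l = l') Iff.rfl

/-- `Ψ_{n,k}`: the CNF formula on `x₁, …, xₙ` consisting of all clauses (on pairwise
distinct variables) containing exactly `k` negative literals and one positive literal. -/
def Psi (n k : ℕ) : CnfFormula n :=
  Finset.univ.filter (fun C : Clause n =>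
    Clause.Wf C ∧ (C.filter (fun l => l.2 = false)).card = k ∧
      (C.filter (fun l => l.2 = true)).card = 1)

/-- The length of a formula: the sum of the numbers of literals of its clauses. -/
def formulaLen {n : ℕ} (φ : CnfFormula n) : ℕ := ∑ C ∈ φ, C.card

/-- A clause `C` is an implicate of a formula `φ`: every total assignment satisfying `φ`
satisfies `C`. -/
def Implicate {n : ℕ} (φ : CnfFormula n) (C : Clause n) : Prop :=
  ∀ a : Fin n → Bool, SatFormula a φ → SatClause a C

/-- A prime implicate: an implicate no proper subset of which is an implicate. -/
def PrimeImplicate {n : ℕ} (φ : CnfFormula n) (C : Clause n) : Prop :=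
  Implicate φ C ∧ ∀ C' : Clause n, C' ⊂ C → ¬ Implicate φ C'

/-- A formula is prime if every one of its clauses is a prime implicate of it. -/
def PrimeFormula {n : ℕ} (φ : CnfFormula n) : Prop :=
  ∀ C ∈ φ, PrimeImplicate φ C

theorem satLit_negLit {n : ℕ} (a : Fin n → Bool) (l : Lit n) :
    SatLit a (negLit l) ↔ ¬ SatLit a l :=
  Bool.eq_not

theorem singleton_mem_unitClauses {n : ℕ} {α : Finset (Lit n)} {l : Lit n} (hl : l ∈ α) :
    {l} ∈ unitClauses α :=
  Finset.mem_image_of_mem _ hl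

theorem satFormula_union_unitClauses {n : ℕ} {a : Fin n → Bool} {φ : CnfFormula n}
    {α : Finset (Lit n)} :
    SatFormula a (φ ∪ unitClauses α) ↔ SatFormula a φ ∧ ∀ l ∈ α, SatLit a l := by
  constructor
  · intro h
    refine ⟨fun C hC => h C (Finset.mem_union_left _ hC), fun l hl => ?_⟩
    simpa [SatClause] using h _ (Finset.mem_union_right _ (singleton_mem_unitClauses hl))
  · rintro ⟨hφ, hα⟩ C hC
    rcases Finset.mem_union.1 hC with hC | hC
    · exact hφ C hC
    · obtain ⟨l, hl, rfl⟩ := Finset.mem_image.1 hC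
      exact ⟨l, Finset.mem_singleton_self l, hα l hl⟩

theorem UcpDeriv.of_mem {n : ℕ} {φ : CnfFormula n} {α : Finset (Lit n)} {l : Lit n}
    (hl : l ∈ α) : UcpDeriv (φ ∪ unitClauses α) l :=
  .step {l} (Finset.mem_union_right _ (singleton_mem_unitClauses hl)) l
    (Finset.mem_singleton_self l) (by simp)

theorem UcpDeriv.satLit {n : ℕ} {φ : CnfFormula n} {a : Fin n → Bool} (ha : SatFormula a φ)
    {l : Lit n} (hl : UcpDeriv φ l) : SatLit a l := by
  induction hl with
  | step C hC l hl _ ih =>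
    obtain ⟨m, hm, hs⟩ := ha C hC
    by_cases hml : m = l
    · exact hml ▸ hs
    · exact absurd hs ((satLit_negLit a m).1 (ih m (Finset.mem_erase.2 ⟨hml, hm⟩)))

theorem not_ucpBot_of_satFormula {n : ℕ} {φ : CnfFormula n} {a : Fin n → Bool}
    (ha : SatFormula a φ) : ¬ UcpBot φ := by
  rintro ⟨C, hC, h⟩
  obtain ⟨l, hl, hs⟩ := ha C hC
  exact (satLit_negLit a l).1 ((h l hl).satLit ha) hs

theorem ucpBot_of_ucpDeriv_negLit {n : ℕ} {φ : CnfFormula n} {l : Lit n}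
    (hl : UcpDeriv φ l) (hl' : UcpDeriv φ (negLit l)) : UcpBot φ := by
  obtain ⟨C, hC, _, hlC, h⟩ := hl
  refine ⟨C, hC, fun m hm => ?_⟩
  by_cases hml : m = l
  · exact hml ▸ hl'
  · exact h m (Finset.mem_erase.2 ⟨hml, hm⟩)

/-- The set of literals satisfied by a total assignment. -/
def assignmentLits {n : ℕ} (a : Fin n → Bool) : Finset (Lit n) :=
  Finset.univ.image fun i => (i, a i)

theorem mem_assignmentLits {n : ℕ} {a : Fin n → Bool} {l : Lit n} :
    l ∈ assignmentLits a ↔ SatLit a l := by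
  obtain ⟨i, b⟩ := l
  simp [assignmentLits, SatLit]

theorem isPartialAssignment_assignmentLits {n : ℕ} (a : Fin n → Bool) :
    IsPartialAssignment (assignmentLits a) := by
  intro l hl
  rw [mem_assignmentLits] at hl ⊢
  simpa [satLit_negLit] using hl

theorem ucpBot_assignmentLits_iff {n : ℕ} {φ : CnfFormula n} {a : Fin n → Bool} :
    UcpBot (φ ∪ unitClauses (assignmentLits a)) ↔ ¬ SatFormula a φ := by
  constructor
  · intro h ha
    exact not_ucpBot_of_satFormula
      (satFormula_union_unitClauses.2 ⟨ha, fun l hl => mem_assignmentLits.1 hl⟩) h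
  · intro h
    simp only [SatFormula, SatClause, not_forall, not_exists, not_and] at h
    obtain ⟨C, hC, hCa⟩ := h
    exact ⟨C, Finset.mem_union_left _ hC, fun l hl =>
      .of_mem (mem_assignmentLits.2 ((satLit_negLit a l).2 (hCa l hl)))⟩

theorem UcpEquiv.satFormula_iff {n : ℕ} {φ ψ : CnfFormula n} (h : UcpEquiv φ ψ)
    (a : Fin n → Bool) : SatFormula a φ ↔ SatFormula a ψ := by
  have := (h _ (isPartialAssignment_assignmentLits a)).1
  rwa [ucpBot_assignmentLits_iff, ucpBot_assignmentLits_iff, not_iff_not] at this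

/-- A formula is propagation complete if, under every partial assignment not refuted by unit
propagation, each literal that is not derived is falsified by some model extending it. -/
def PropagationComplete {n : ℕ} (ψ : CnfFormula n) : Prop :=
  ∀ α : Finset (Lit n), ¬ UcpBot (ψ ∪ unitClauses α) →
    ∀ l, ¬ UcpDeriv (ψ ∪ unitClauses α) l →
      ∃ a, SatFormula a (ψ ∪ unitClauses α) ∧ ¬ SatLit a l

theorem PropagationComplete.exists_satFormula {n : ℕ} (hn : 0 < n) {ψ : CnfFormula n}
    (hψ : PropagationComplete ψ) {α : Finset (Lit n)} (h : ¬ UcpBot (ψ ∪ unitClauses α)) :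
    ∃ a, SatFormula a (ψ ∪ unitClauses α) := by
  let l : Lit n := (⟨0, hn⟩, true)
  by_cases hl : UcpDeriv (ψ ∪ unitClauses α) l
  · obtain ⟨a, ha, -⟩ := hψ α h (negLit l) fun hl' => h (ucpBot_of_ucpDeriv_negLit hl hl')
    exact ⟨a, ha⟩
  · obtain ⟨a, ha, -⟩ := hψ α h l hl
    exact ⟨a, ha⟩

theorem exists_subclause_union_unitClauses {n : ℕ} {φ φ' : CnfFormula n}
    (hsub : ∀ C ∈ φ, ∃ C' ∈ φ', C' ⊆ C) (α : Finset (Lit n)) :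
    ∀ C ∈ φ ∪ unitClauses α, ∃ C' ∈ φ' ∪ unitClauses α, C' ⊆ C := by
  intro C hC
  rcases Finset.mem_union.1 hC with hC | hC
  · obtain ⟨C', hC', h⟩ := hsub C hC
    exact ⟨C', Finset.mem_union_left _ hC', h⟩
  · exact ⟨C, Finset.mem_union_right _ hC, subset_rfl⟩

theorem UcpDeriv.of_subclauses {n : ℕ} {φ φ' : CnfFormula n}
    (hsub : ∀ C ∈ φ, ∃ C' ∈ φ', C' ⊆ C) (hbot : ¬ UcpBot φ') {l : Lit n}
    (hl : UcpDeriv φ l) : UcpDeriv φ' l := by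
  induction hl with
  | step C hC l _ _ ih =>
    obtain ⟨C', hC', h⟩ := hsub C hC
    by_cases hlC' : l ∈ C'
    · exact .step C' hC' l hlC' fun m hm => ih m (Finset.erase_subset_erase l h hm)
    · refine absurd ⟨C', hC', fun m hm => ih m (Finset.mem_erase.2 ⟨?_, h hm⟩)⟩ hbot
      rintro rfl
      exact hlC' hm

theorem ucpBot_of_subclauses {n : ℕ} {φ φ' : CnfFormula n}
    (hsub : ∀ C ∈ φ, ∃ C' ∈ φ', C' ⊆ C) (hbot : UcpBot φ) : UcpBot φ' := by
  by_contra hbot'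
  obtain ⟨C, hC, h⟩ := hbot
  obtain ⟨C', hC', hCC'⟩ := hsub C hC
  exact hbot' ⟨C', hC', fun l hl => (h l (hCC' hl)).of_subclauses hsub hbot'⟩

/-- Shrinking clauses to sub-implicates preserves ucp-equivalence to a propagation complete
formula. -/
theorem UcpEquiv.of_subclauses {n : ℕ} (hn : 0 < n) {φ φ' ψ : CnfFormula n}
    (h : UcpEquiv φ ψ) (hψ : PropagationComplete ψ) (hsub : ∀ C ∈ φ, ∃ C' ∈ φ', C' ⊆ C)
    (himp : ∀ a, SatFormula a ψ → SatFormula a φ') : UcpEquiv φ' ψ := by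
  intro α hα
  obtain ⟨hb, hs⟩ := h α hα
  have hsubα := exists_subclause_union_unitClauses hsub α
  have himpα : ∀ a, SatFormula a (ψ ∪ unitClauses α) → SatFormula a (φ' ∪ unitClauses α) := by
    intro a ha
    rw [satFormula_union_unitClauses] at ha ⊢
    exact ⟨himp a ha.1, ha.2⟩
  have hb' : UcpBot (φ' ∪ unitClauses α) ↔ UcpBot (ψ ∪ unitClauses α) := by
    refine ⟨fun hbot => ?_, fun hbot => ucpBot_of_subclauses hsubα (hb.2 hbot)⟩
    by_contra hbot'
    obtain ⟨a, ha⟩ := hψ.exists_satFormula hn hbot'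
    exact not_ucpBot_of_satFormula (himpα a ha) hbot
  refine ⟨hb', fun hbot => Set.Subset.antisymm (fun l hl => ?_) ?_⟩
  · by_contra hl'
    obtain ⟨a, ha, hal⟩ := hψ α (fun hbot' => hbot (hb'.2 hbot')) l hl'
    exact hal (UcpDeriv.satLit (himpα a ha) hl)
  · rw [← hs fun hbot' => hbot (hb'.2 (hb.1 hbot'))]
    exact fun l hl => UcpDeriv.of_subclauses hsubα hbot hl

theorem Implicate.exists_primeImplicate_subset {n : ℕ} {φ : CnfFormula n} {C : Clause n}
    (h : Implicate φ C) : ∃ C' ⊆ C, PrimeImplicate φ C' := by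
  induction C using Finset.strongInduction with
  | H C ih =>
    by_cases hp : PrimeImplicate φ C
    · exact ⟨C, subset_rfl, hp⟩
    · simp only [PrimeImplicate, h, true_and, not_forall, not_not] at hp
      obtain ⟨D, hDC, hD⟩ := hp
      obtain ⟨C', hC', hp'⟩ := ih D hDC hD
      exact ⟨C', hC'.trans hDC.1, hp'⟩

theorem PrimeImplicate.congr {n : ℕ} {φ ψ : CnfFormula n}
    (h : ∀ a, SatFormula a φ ↔ SatFormula a ψ) {C : Clause n} (hC : PrimeImplicate φ C) :
    PrimeImplicate ψ C := by
  simpa only [PrimeImplicate, Implicate, h] using hC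

/-- The clause stating that the truth of all variables in `S` implies the truth of `x_j`. -/
def implClause {n : ℕ} (S : Finset (Fin n)) (j : Fin n) : Clause n :=
  insert (j, true) (S.image fun i => (i, false))

theorem implClause_mem_Psi {n k : ℕ} {S : Finset (Fin n)} {j : Fin n} (hS : S.card = k)
    (hj : j ∉ S) : implClause S j ∈ Psi n k := by
  have hneg : (implClause S j).filter (fun l => l.2 = false) = S.image fun i => (i, false) := by
    ext ⟨i, b⟩
    cases b <;> simp [implClause]
  have hpos : (implClause S j).filter (fun l => l.2 = true) = {(j, true)} := by
    ext ⟨i, b⟩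
    cases b <;> simp [implClause]
  refine Finset.mem_filter.2 ⟨Finset.mem_univ _, ?_, ?_, ?_⟩
  · rintro ⟨i, b⟩ hi ⟨i', b'⟩ hi' rfl
    cases b <;> cases b' <;> simp_all [implClause]
  · rw [hneg, Finset.card_image_of_injective _ (Prod.mk_left_injective false), hS]
  · rw [hpos, Finset.card_singleton]

theorem satFormula_Psi_of_card_lt {n k : ℕ} {S : Finset (Fin n)} (hS : S.card < k) :
    SatFormula (fun i => decide (i ∈ S)) (Psi n k) := by
  intro C hC
  obtain ⟨-, -, hk, -⟩ := Finset.mem_filter.1 hC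
  by_contra hsat
  simp only [SatClause, SatLit, not_exists, not_and] at hsat
  have hsub : C.filter (fun l => l.2 = false) ⊆ S.image fun i => (i, false) := by
    rintro ⟨i, b⟩ hl
    obtain ⟨hl, rfl : b = false⟩ := Finset.mem_filter.1 hl
    simpa using hsat _ hl
  have := (Finset.card_le_card hsub).trans Finset.card_image_le
  omega

theorem satFormula_Psi_true (n k : ℕ) : SatFormula (fun _ => true) (Psi n k) := by
  intro C hC
  obtain ⟨-, -, -, h1⟩ := Finset.mem_filter.1 hC
  obtain ⟨l, hl⟩ := Finset.card_pos.1 (h1.symm ▸ Nat.one_pos)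
  obtain ⟨hl, hl2⟩ := Finset.mem_filter.1 hl
  exact ⟨l, hl, hl2.symm⟩

theorem propagationComplete_Psi (n k : ℕ) : PropagationComplete (Psi n k) := by
  classical
  intro α hbot l hl
  let P : Finset (Fin n) :=
    Finset.univ.filter fun i => UcpDeriv (Psi n k ∪ unitClauses α) (i, true)
  have hP : ∀ i, i ∈ P ↔ UcpDeriv (Psi n k ∪ unitClauses α) (i, true) := by simp [P]
  have hcons : ∀ i, i ∈ P → ¬ UcpDeriv (Psi n k ∪ unitClauses α) (i, false) :=
    fun i hi hi' => hbot (ucpBot_of_ucpDeriv_negLit ((hP i).1 hi) hi')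
  rcases le_or_gt k P.card with hcard | hcard
  · obtain ⟨S, hSP, hS⟩ := Finset.exists_subset_card_eq hcard
    have hall : ∀ j, j ∈ P := by
      intro j
      by_cases hj : j ∈ S
      · exact hSP hj
      · rw [hP]
        refine .step _ (Finset.mem_union_left _ (implClause_mem_Psi hS hj)) _
          (Finset.mem_insert_self _ _) ?_
        intro m hm
        obtain ⟨hmj, hm⟩ := Finset.mem_erase.1 hm
        obtain ⟨i, hi, rfl⟩ := Finset.mem_image.1 (Finset.mem_of_mem_insert_of_ne hm hmj)
        exact (hP i).1 (hSP hi)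
    refine ⟨fun _ => true, satFormula_union_unitClauses.2 ⟨satFormula_Psi_true n k, ?_⟩, ?_⟩
    · rintro ⟨i, b⟩ hi
      cases b
      · exact absurd (.of_mem hi) (hcons i (hall i))
      · rfl
    · obtain ⟨i, b⟩ := l
      cases b
      · simp [SatLit]
      · exact absurd ((hP i).1 (hall i)) hl
  · have hmodel : ∀ S : Finset (Fin n), P ⊆ S → S.card < k →
        (∀ i ∈ S, ¬ UcpDeriv (Psi n k ∪ unitClauses α) (i, false)) →
        SatFormula (fun i => decide (i ∈ S)) (Psi n k ∪ unitClauses α) := by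
      intro S hPS hS hSneg
      refine satFormula_union_unitClauses.2 ⟨satFormula_Psi_of_card_lt hS, ?_⟩
      rintro ⟨i, b⟩ hi
      cases b
      · simpa [SatLit] using fun hiS => hSneg i hiS (.of_mem hi)
      · simpa [SatLit] using hPS ((hP i).2 (.of_mem hi))
    obtain ⟨y, b⟩ := l
    cases b
    · by_cases hcard' : (insert y P).card < k
      · refine ⟨_, hmodel _ (Finset.subset_insert y P) hcard' ?_, by simp [SatLit]⟩
        intro i hi
        rcases Finset.mem_insert.1 hi with rfl | hi
        · exact hl
        · exact hcons i hi
      · have hcardEq : (insert y P).card = k := by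
          have := Finset.card_insert_le y P
          omega
        refine ⟨fun _ => true, satFormula_union_unitClauses.2 ⟨satFormula_Psi_true n k, ?_⟩,
          by simp [SatLit]⟩
        rintro ⟨j, b⟩ hj
        cases b
        · have hjd : UcpDeriv (Psi n k ∪ unitClauses α) (j, false) := .of_mem hj
          have hjS : j ∉ insert y P := by
            intro hjS
            rcases Finset.mem_insert.1 hjS with rfl | hjP
            · exact hl hjd
            · exact hcons j hjP hjd
          refine absurd ?_ hl
          refine .step _ (Finset.mem_union_left _ (implClause_mem_Psi hcardEq hjS)) _
            (by simp [implClause]) ?_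
          intro m hm
          obtain ⟨hmy, hm⟩ := Finset.mem_erase.1 hm
          rcases Finset.mem_insert.1 hm with rfl | hm
          · exact hjd
          · obtain ⟨i, hi, rfl⟩ := Finset.mem_image.1 hm
            rcases Finset.mem_insert.1 hi with rfl | hi
            · exact absurd rfl hmy
            · exact (hP i).1 hi
        · rfl
    · exact ⟨_, hmodel P subset_rfl hcard hcons, by simpa [SatLit, hP] using hl⟩

/-- If `φ` is an arbitrary CNF formula ucp-equivalent to `Ψ_{n,k}`
(where `1 ≤ k ≤ n−1`), then there is a prime CNF formula `φ'` ucp-equivalent to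
`Ψ_{n,k}` such that `|φ'| ≤ |φ|` and `‖φ'‖ ≤ ‖φ‖`. -/
theorem exists_prime_ucpEquivalent {n k : ℕ} (hk : 1 ≤ k) (hkn : k + 1 ≤ n)
    (φ : CnfFormula n) (hwf : ∀ C ∈ φ, Clause.Wf C)
    (h : UcpEquiv φ (Psi n k)) :
    ∃ φ' : CnfFormula n, (∀ C ∈ φ', Clause.Wf C) ∧ PrimeFormula φ' ∧
      UcpEquiv φ' (Psi n k) ∧ φ'.card ≤ φ.card ∧ formulaLen φ' ≤ formulaLen φ := by
  have himp : ∀ C ∈ φ, Implicate (Psi n k) C := fun C hC a ha => (h.satFormula_iff a).2 ha C hC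
  choose! f hfsub hfprime using fun C hC => (himp C hC).exists_primeImplicate_subset
  have hsub : ∀ C ∈ φ, ∃ C' ∈ φ.image f, C' ⊆ C := fun C hC =>
    ⟨f C, Finset.mem_image_of_mem f hC, hfsub C hC⟩
  have hequiv : UcpEquiv (φ.image f) (Psi n k) := by
    refine h.of_subclauses (by omega) (propagationComplete_Psi n k) hsub fun a ha C' hC' => ?_
    obtain ⟨C, hC, rfl⟩ := Finset.mem_image.1 hC'
    exact (hfprime C hC).1 a ha
  refine ⟨φ.image f, ?_, ?_, hequiv, Finset.card_image_le, ?_⟩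
  · intro C' hC'
    obtain ⟨C, hC, rfl⟩ := Finset.mem_image.1 hC'
    exact fun l hl l' hl' => hwf C hC l (hfsub C hC hl) l' (hfsub C hC hl')
  · intro C' hC'
    obtain ⟨C, hC, rfl⟩ := Finset.mem_image.1 hC'
    exact (hfprime C hC).congr fun a => (hequiv.satFormula_iff a).symm
  · calc formulaLen (φ.image f) ≤ ∑ C ∈ φ, (f C).card :=
          Finset.sum_image_le_of_nonneg fun _ _ => Nat.zero_le _
      _ ≤ formulaLen φ := Finset.sum_le_sum fun C hC => Finset.card_le_card (hfsub C hC)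
end

section
/- A formula φ ⊆ Ψ_{n,k} (with 1 ≤ k ≤ n−1) is ucp-equivalent to Ψ_{n,k} if and only if for every (k−1)-element set A ⊆ X of variables, the directed graph G^d(φ, A) is strongly connected on the vertex set X∖A. -/
/-- `neg(A)`: the set of negative literals on the variables in `A`. -/
def negVars {n : ℕ} (A : Finset (Fin n)) : Finset (Lit n) := A.image (fun x => (x, false))

/-- The set of positive literals on the variables in `A`. -/
def posVars {n : ℕ} (A : Finset (Fin n)) : Finset (Lit n) := A.image (fun x => (x, true))

/-- The directed graph `G^d(φ, A)` on `X ∖ A`: directed edge `(x_i, x_j)` whenever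
`neg(A) ∪ {¬x_i, x_j} ∈ φ`. -/
def GdEdge {n : ℕ} (φ : CnfFormula n) (A : Finset (Fin n)) (i j : Fin n) : Prop :=
  insert ((i, false) : Lit n) (insert ((j, true) : Lit n) (negVars A)) ∈ φ

/-- The clause `neg(B) ∪ {x_j}`. -/
def hornClause {n : ℕ} (B : Finset (Fin n)) (j : Fin n) : Clause n :=
  insert (j, true) (negVars B)

section

variable {n k : ℕ} {φ ψ : CnfFormula n}

@[simp]
lemma mk_mem_hornClause {B : Finset (Fin n)} {j x : Fin n} {s : Bool} :
    ((x, s) : Lit n) ∈ hornClause B j ↔ x = j ∧ s = true ∨ x ∈ B ∧ s = false := by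
  simp only [hornClause, negVars, Finset.mem_insert, Finset.mem_image, Prod.mk.injEq]
  grind

lemma exists_hornClause_of_mem_Psi {C : Clause n} (hC : C ∈ Psi n k) :
    ∃ B j, B.card = k ∧ j ∉ B ∧ C = hornClause B j := by
  simp only [Psi, Finset.mem_filter, Finset.mem_univ, true_and] at hC
  obtain ⟨hwf, hneg, hpos⟩ := hC
  obtain ⟨⟨j, s⟩, hj⟩ := Finset.card_eq_one.mp hpos
  have hmem : ∀ l : Lit n, l ∈ C ∧ l.2 = true ↔ l = (j, s) := fun l => by
    rw [← Finset.mem_singleton (a := (j, s)), ← hj, Finset.mem_filter]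
  obtain ⟨hjC, rfl⟩ : (j, s) ∈ C ∧ s = true := (hmem (j, s)).mpr rfl
  refine ⟨(C.filter (fun l => l.2 = false)).image Prod.fst, j, ?_, ?_, ?_⟩
  · rw [Finset.card_image_of_injOn, hneg]
    intro a ha b hb hab
    simp only [Finset.coe_filter, Set.mem_ofPred_eq] at ha hb
    exact Prod.ext hab (ha.2.trans hb.2.symm)
  · intro h
    obtain ⟨l, hl, hlj⟩ := Finset.mem_image.mp h
    rw [Finset.mem_filter] at hl
    have := hwf l hl.1 _ hjC hlj
    simp [this] at hl
  · ext ⟨x, s⟩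
    have := hmem (x, s)
    cases s <;> simp_all

lemma hornClause_mem_Psi {B : Finset (Fin n)} {j : Fin n} (hB : B.card = k) (hj : j ∉ B) :
    hornClause B j ∈ Psi n k := by
  have hneg : (hornClause B j).filter (fun l => l.2 = false) = negVars B := by
    ext ⟨x, s⟩
    simp only [Finset.mem_filter, mk_mem_hornClause, negVars, Finset.mem_image, Prod.mk.injEq]
    grind
  have hpos : (hornClause B j).filter (fun l => l.2 = true) = {(j, true)} := by
    ext ⟨x, s⟩
    simp only [Finset.mem_filter, mk_mem_hornClause, Finset.mem_singleton, Prod.mk.injEq]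
    grind
  simp only [Psi, Finset.mem_filter, Finset.mem_univ, true_and]
  refine ⟨?_, ?_, ?_⟩
  · rintro ⟨x, s⟩ hl ⟨y, t⟩ hl' (rfl : x = y)
    rw [mk_mem_hornClause] at hl hl'
    grind
  · rw [hneg, negVars, Finset.card_image_of_injective _ (Prod.mk_left_injective false), hB]
  · rw [hpos, Finset.card_singleton]

lemma gdEdge_iff {A : Finset (Fin n)} {i j : Fin n} :
    GdEdge φ A i j ↔ hornClause (insert i A) j ∈ φ := by
  rw [GdEdge, hornClause, negVars, negVars, Finset.image_insert, Finset.insert_comm]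

lemma UcpDeriv.mono (h : φ ⊆ ψ) {l : Lit n} (hl : UcpDeriv φ l) : UcpDeriv ψ l := by
  induction hl with
  | step C hC l hl _ ih => exact .step C (h hC) l hl ih

lemma UcpBot.mono (h : φ ⊆ ψ) (hφ : UcpBot φ) : UcpBot ψ := by
  obtain ⟨C, hC, hl⟩ := hφ
  exact ⟨C, h hC, fun l hlC => (hl l hlC).mono h⟩

lemma ucpBot_of_complementary {l : Lit n} (hl : UcpDeriv φ l) (hl' : UcpDeriv φ (negLit l)) :
    UcpBot φ := by
  obtain ⟨C, hC, _, _, h⟩ := hl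
  refine ⟨C, hC, fun m hm => ?_⟩
  by_cases hml : m = l
  · exact hml ▸ hl'
  · exact h m (Finset.mem_erase.mpr ⟨hml, hm⟩)

lemma ucpDeriv_of_mem {α : Finset (Lit n)} {l : Lit n} (hl : l ∈ α) :
    UcpDeriv (φ ∪ unitClauses α) l :=
  .step {l} (Finset.mem_union_right _ (Finset.mem_image_of_mem _ hl)) l
    (Finset.mem_singleton_self l) (by simp)

lemma ucpDeriv_true_of_hornClause {B : Finset (Fin n)} {j : Fin n} (hC : hornClause B j ∈ φ)
    (hB : ∀ b ∈ B, UcpDeriv φ (b, true)) : UcpDeriv φ (j, true) := by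
  refine .step _ hC _ (by simp) ?_
  rintro ⟨x, s⟩ hx
  rw [Finset.mem_erase, mk_mem_hornClause] at hx
  obtain ⟨hne, ⟨rfl, rfl⟩ | ⟨hxB, rfl⟩⟩ := hx
  · exact absurd rfl hne
  · exact hB x hxB

lemma ucpDeriv_false_of_hornClause {B : Finset (Fin n)} {i j : Fin n}
    (hC : hornClause B j ∈ φ) (hi : i ∈ B) (hB : ∀ b ∈ B, b ≠ i → UcpDeriv φ (b, true))
    (hj : UcpDeriv φ (j, false)) : UcpDeriv φ (i, false) := by
  refine .step _ hC _ (by simp [hi]) ?_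
  rintro ⟨x, s⟩ hx
  rw [Finset.mem_erase, mk_mem_hornClause] at hx
  obtain ⟨hne, ⟨rfl, rfl⟩ | ⟨hxB, rfl⟩⟩ := hx
  · exact hj
  · exact hB x hxB (fun h => hne (h ▸ rfl))

lemma ucpDeriv_true_of_reachable {A : Finset (Fin n)} {i j : Fin n} (hφ : φ ⊆ ψ)
    (hA : ∀ a ∈ A, UcpDeriv ψ (a, true)) (h : Relation.ReflTransGen (GdEdge φ A) i j)
    (hi : UcpDeriv ψ (i, true)) : UcpDeriv ψ (j, true) := by
  induction h with
  | refl => exact hi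
  | tail _ hbc ih =>
    refine ucpDeriv_true_of_hornClause (hφ (gdEdge_iff.mp hbc)) fun x hx => ?_
    obtain rfl | hx := Finset.mem_insert.mp hx
    exacts [ih, hA x hx]

lemma ucpDeriv_false_of_reachable {A : Finset (Fin n)} {i j : Fin n} (hφ : φ ⊆ ψ)
    (hA : ∀ a ∈ A, UcpDeriv ψ (a, true)) (h : Relation.ReflTransGen (GdEdge φ A) i j)
    (hj : UcpDeriv ψ (j, false)) : UcpDeriv ψ (i, false) := by
  induction h using Relation.ReflTransGen.head_induction_on with
  | refl => exact hj
  | head hab _ ih =>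
    refine ucpDeriv_false_of_hornClause (hφ (gdEdge_iff.mp hab)) (Finset.mem_insert_self _ _)
      (fun x hx hne => ?_) ih
    exact hA x (Finset.mem_of_mem_insert_of_ne hx hne)

lemma ucpDeriv_of_psi_of_strongly_connected (hk : 1 ≤ k)
    (hconn : ∀ A : Finset (Fin n), A.card + 1 = k →
      ∀ i ∉ A, ∀ j ∉ A, Relation.ReflTransGen (GdEdge φ A) i j)
    {χ : CnfFormula n} {l : Lit n} (hl : UcpDeriv (Psi n k ∪ χ) l) : UcpDeriv (φ ∪ χ) l := by
  have hsub : φ ⊆ φ ∪ χ := Finset.subset_union_left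
  induction hl with
  | step C hC l hl _ ih =>
    obtain hC | hC := Finset.mem_union.mp hC
    · obtain ⟨B, j, hB, hj, rfl⟩ := exists_hornClause_of_mem_Psi hC
      have hpath : ∀ i ∈ B, Relation.ReflTransGen (GdEdge φ (B.erase i)) i j := fun i hi =>
        hconn _ (by rw [Finset.card_erase_add_one hi, hB]) _ (Finset.notMem_erase _ _) _
          (fun h => hj (Finset.mem_of_mem_erase h))
      obtain ⟨x, s⟩ := l
      obtain ⟨rfl, rfl⟩ | ⟨hxB, rfl⟩ := mk_mem_hornClause.mp hl
      · have hpos : ∀ b ∈ B, UcpDeriv (φ ∪ χ) (b, true) := fun b hb =>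
          ih (b, false) (by simp [hb])
        obtain ⟨i, hi⟩ : B.Nonempty := Finset.card_pos.mp (by omega)
        exact ucpDeriv_true_of_reachable hsub (fun a ha => hpos a (Finset.mem_of_mem_erase ha))
          (hpath i hi) (hpos i hi)
      · refine ucpDeriv_false_of_reachable hsub (fun a ha => ?_) (hpath x hxB)
          (ih (j, true) (by simp))
        obtain ⟨hne, ha⟩ := Finset.mem_erase.mp ha
        exact ih (a, false) (by simp [hne, ha])
    · exact .step C (Finset.mem_union_right _ hC) l hl ih

lemma ucpEquiv_psi_of_strongly_connected (hk : 1 ≤ k) (hφ : φ ⊆ Psi n k)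
    (hconn : ∀ A : Finset (Fin n), A.card + 1 = k →
      ∀ i ∉ A, ∀ j ∉ A, Relation.ReflTransGen (GdEdge φ A) i j) :
    UcpEquiv φ (Psi n k) := by
  intro α _
  have hsub : φ ∪ unitClauses α ⊆ Psi n k ∪ unitClauses α := Finset.union_subset_union_left hφ
  refine ⟨⟨UcpBot.mono hsub, ?_⟩, fun _ => ?_⟩
  · rintro ⟨C, hC, h⟩
    have h' := fun l hl => ucpDeriv_of_psi_of_strongly_connected hk hconn (h l hl)
    obtain hCψ | hCα := Finset.mem_union.mp hC
    · obtain ⟨B, j, _, _, rfl⟩ := exists_hornClause_of_mem_Psi hCψ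
      refine ucpBot_of_complementary (l := (j, true)) ?_ (h' _ (by simp))
      exact ucpDeriv_of_psi_of_strongly_connected hk hconn
        (ucpDeriv_true_of_hornClause hC fun b hb => h (b, false) (by simp [hb]))
    · exact ⟨C, Finset.mem_union_right _ hCα, h'⟩
  · ext l
    exact ⟨UcpDeriv.mono hsub, ucpDeriv_of_psi_of_strongly_connected hk hconn⟩

/-- The literals true on `A` and false outside `A ∪ R`. -/
def cutAssignment (A : Finset (Fin n)) (R : Set (Fin n)) : Set (Lit n) :=
  {l | l.1 ∈ A ∧ l.2 = true ∨ l.1 ∉ A ∧ l.1 ∉ R ∧ l.2 = false}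

lemma negLit_notMem_cutAssignment {A : Finset (Fin n)} {R : Set (Fin n)} {l : Lit n}
    (hl : l ∈ cutAssignment A R) : negLit l ∉ cutAssignment A R := by
  simp only [cutAssignment, negLit, Set.mem_ofPred_eq] at *
  grind

lemma exists_notMem_cutAssignment {A B : Finset (Fin n)} (R : Set (Fin n))
    (h : A.card < B.card) : ∃ b ∈ B, ((b, true) : Lit n) ∉ cutAssignment A R := by
  obtain ⟨b, hb, hbA⟩ := Finset.exists_mem_notMem_of_card_lt_card h
  exact ⟨b, hb, by simp [cutAssignment, hbA]⟩

/-- If no edge of `G^d(φ, A)` leaves `R`, unit propagation on `φ` adds nothing to the assignment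
that is true on `A` and false outside `A ∪ R`. -/
lemma mem_cutAssignment_of_ucpDeriv (hφ : φ ⊆ Psi n k) {A : Finset (Fin n)}
    (hA : A.card + 1 = k) {R : Set (Fin n)} (hR : ∀ a ∈ R, ∀ b, GdEdge φ A a b → b ∈ R)
    {α : Finset (Lit n)} (hα : ∀ l ∈ α, l ∈ cutAssignment A R) {l : Lit n}
    (hl : UcpDeriv (φ ∪ unitClauses α) l) : l ∈ cutAssignment A R := by
  induction hl with
  | step C hC l hl _ ih =>
    obtain hC | hC := Finset.mem_union.mp hC
    · obtain ⟨B, j, hB, hj, rfl⟩ := exists_hornClause_of_mem_Psi (hφ hC)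
      obtain ⟨x, s⟩ := l
      obtain ⟨rfl, rfl⟩ | ⟨hxB, rfl⟩ := mk_mem_hornClause.mp hl
      · obtain ⟨b, hb, hbA⟩ := exists_notMem_cutAssignment R (show A.card < B.card by omega)
        exact absurd (ih (b, false) (by simp [hb])) hbA
      · have hsub : B.erase x ⊆ A := fun b hb => by
          obtain ⟨hne, hb⟩ := Finset.mem_erase.mp hb
          simpa [cutAssignment, negLit] using ih (b, false) (by simp [hne, hb])
        have heq : B.erase x = A := Finset.eq_of_subset_of_card_le hsub (by
          have := Finset.card_erase_add_one hxB
          omega)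
        have hjR : j ∉ R := by
          have := ih (j, true) (by simp)
          simp only [cutAssignment, negLit, Set.mem_ofPred_eq] at this
          grind
        have hedge : GdEdge φ A x j := by
          rwa [gdEdge_iff, ← heq, Finset.insert_erase hxB]
        exact Or.inr ⟨heq ▸ Finset.notMem_erase _ _, fun hx => hjR (hR x hx j hedge), rfl⟩
    · obtain ⟨m, hm, rfl⟩ := Finset.mem_image.mp hC
      obtain rfl := Finset.mem_singleton.mp hl
      exact hα l hm

lemma strongly_connected_of_ucpEquiv_psi (hφ : φ ⊆ Psi n k) (h : UcpEquiv φ (Psi n k))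
    {A : Finset (Fin n)} (hA : A.card + 1 = k) {i j : Fin n} (hi : i ∉ A) (hj : j ∉ A) :
    Relation.ReflTransGen (GdEdge φ A) i j := by
  classical
  by_contra hij
  set R : Set (Fin n) := {x | Relation.ReflTransGen (GdEdge φ A) i x}
  have hR : ∀ a ∈ R, ∀ b, GdEdge φ A a b → b ∈ R := fun a ha b hab =>
    Relation.ReflTransGen.tail ha hab
  have hiR : i ∈ R := Relation.ReflTransGen.refl
  have hjR : j ∉ R := hij
  have hne : j ≠ i := fun hji => hjR (hji ▸ hiR)
  let α : Finset (Lit n) := Finset.univ.filter (· ∈ cutAssignment A R)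
  have hmem : ∀ l, l ∈ α ↔ l ∈ cutAssignment A R := fun l => by simp [α]
  have hcut : ∀ l, UcpDeriv (φ ∪ unitClauses α) l → l ∈ cutAssignment A R := fun l =>
    mem_cutAssignment_of_ucpDeriv hφ hA hR fun l hl => (hmem l).mp hl
  have hpa : IsPartialAssignment α := fun l hl hl' =>
    negLit_notMem_cutAssignment ((hmem l).mp hl) ((hmem _).mp hl')
  have hbot : ¬ UcpBot (φ ∪ unitClauses α) := by
    rintro ⟨C, hC, hCl⟩
    obtain hC | hC := Finset.mem_union.mp hC
    · obtain ⟨B, m, hB, _, rfl⟩ := exists_hornClause_of_mem_Psi (hφ hC)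
      obtain ⟨b, hb, hbA⟩ := exists_notMem_cutAssignment R (show A.card < B.card by omega)
      exact hbA (hcut _ (hCl (b, false) (by simp [hb])))
    · obtain ⟨m, hm, rfl⟩ := Finset.mem_image.mp hC
      exact negLit_notMem_cutAssignment ((hmem m).mp hm)
        (hcut _ (hCl m (Finset.mem_singleton_self m)))
  have hψ : UcpDeriv (Psi n k ∪ unitClauses α) (i, false) := by
    refine ucpDeriv_false_of_hornClause (B := insert i A) (j := j)
      (Finset.mem_union_left _ (hornClause_mem_Psi ?_ ?_)) (Finset.mem_insert_self _ _)
      (fun b hb hbi => ucpDeriv_of_mem ((hmem _).mpr ?_)) (ucpDeriv_of_mem ((hmem _).mpr ?_))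
    · rw [Finset.card_insert_of_notMem hi, hA]
    · simp [hne, hj]
    · exact Or.inl ⟨Finset.mem_of_mem_insert_of_ne hb hbi, rfl⟩
    · exact Or.inr ⟨hj, hjR, rfl⟩
  have hφi : UcpDeriv (φ ∪ unitClauses α) (i, false) :=
    ((h α hpa).2 hbot).symm.subset hψ
  simpa [cutAssignment, hiR] using hcut _ hφi

end

/-- A formula `φ ⊆ Ψ_{n,k}` (with `1 ≤ k ≤ n−1`) is ucp-equivalent to
`Ψ_{n,k}` if and only if for every `(k−1)`-element set `A ⊆ X` of variables, the directed
graph `G^d(φ, A)` is strongly connected on the vertex set `X ∖ A` (every vertex is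
reachable from every other by a directed path). -/
theorem ucpEquiv_psi_iff_strongly_connected {n k : ℕ} (hk : 1 ≤ k) (hkn : k + 1 ≤ n)
    (φ : CnfFormula n) (hφ : φ ⊆ Psi n k) :
    UcpEquiv φ (Psi n k) ↔
      ∀ A : Finset (Fin n), A.card + 1 = k →
        ∀ i ∉ A, ∀ j ∉ A, Relation.ReflTransGen (GdEdge φ A) i j := by
  exact ⟨fun h A hA i hi j hj => strongly_connected_of_ucpEquiv_psi hφ h hA hi hj,
    ucpEquiv_psi_of_strongly_connected hk hφ⟩
end
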